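/- Let h ≥ 1 be an integer, u ∈ 𝔽_h, v' ∈ 𝔽_h, and for ζ > 0 define J̃_ζ : 𝔽_h → ℝ by J̃_ζ(v) := J_h(u, v) + (ζ/2) ∫_Ω P_h(([v − v']₊)²) dx, where [s]₊ := max(s, 0). Then for every ζ > 0 the functional J̃_ζ is strictly convex and coercive on 𝔽_h and admits a unique minimizer v_ζ; moreover, as ζ → ∞, v_ζ converges in 𝔽_h to the unique minimizer v* of J_h(u, ·) over { v ∈ 𝔽_h : v ≤ v' on Ω }, and min_{𝔽_h} J̃_ζ → J_h(u, v*). -/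

import Mathlib

open MeasureTheory Filter
open scoped Classical
open scoped RealInnerProductSpace

noncomputable section

abbrev E2 : Type := EuclideanSpace ℝ (Fin 2)

/-- The point `(a, b) ∈ ℝ²`. -/
def vtx (a b : ℝ) : E2 := (WithLp.equiv 2 (Fin 2 → ℝ)).symm ![a, b]

/-- The open unit square `Ω = (0,1)²`. -/
def Omega : Set E2 := {x | x 0 ∈ Set.Ioo (0:ℝ) 1 ∧ x 1 ∈ Set.Ioo (0:ℝ) 1}

/-- The closed unit square `Ω̄ = [0,1]²`. -/
def OmegaCl : Set E2 := {x | x 0 ∈ Set.Icc (0:ℝ) 1 ∧ x 1 ∈ Set.Icc (0:ℝ) 1}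

/-- The boundary `∂Ω = Ω̄ \ Ω`. -/
def OmegaBd : Set E2 := OmegaCl \ Omega

/-- Lower-left triangle `K⁺_{k,j}` of the uniform triangulation `𝒯_h`. -/
def Kplus (h k j : ℕ) : Set E2 :=
  {x | ((k:ℝ)-1)/h ≤ x 0 ∧ x 0 ≤ (k:ℝ)/h ∧ ((j:ℝ)-1)/h ≤ x 1 ∧
        x 1 ≤ ((j:ℝ)-1)/h + ((k:ℝ)/h - x 0)}

/-- Upper-right triangle `K⁻_{k,j}` of the uniform triangulation `𝒯_h`. -/
def Kminus (h k j : ℕ) : Set E2 :=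
  {x | ((k:ℝ)-1)/h ≤ x 0 ∧ x 0 ≤ (k:ℝ)/h ∧ (j:ℝ)/h + (((k:ℝ)-1)/h - x 0) ≤ x 1 ∧
        x 1 ≤ (j:ℝ)/h}

/-- `u` is affine on the set `S`. -/
def IsAffineOn (u : E2 → ℝ) (S : Set E2) : Prop :=
  ∃ (b : E2) (c : ℝ), ∀ x ∈ S, u x = ⟪b, x⟫ + c

/-- Membership in the finite element space `𝔽_h`: continuous on `Ω̄` and affine on every
triangle of the uniform triangulation `𝒯_h`. -/
def MemF (h : ℕ) (u : E2 → ℝ) : Prop :=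
  ContinuousOn u OmegaCl ∧
  ∀ k j : ℕ, 1 ≤ k → k ≤ h → 1 ≤ j → j ≤ h →
    IsAffineOn u (Kplus h k j) ∧ IsAffineOn u (Kminus h k j)

/-- The set `Δ_h` of vertices of the triangulation `𝒯_h`. -/
def Delta (h : ℕ) : Set E2 :=
  {x | ∃ k j : ℕ, k ≤ h ∧ j ≤ h ∧ x = vtx ((k:ℝ)/h) ((j:ℝ)/h)}

/-- The vertex `(k/h, j/h)` of `𝒯_h`. -/
def vertexPt (h k j : ℕ) : E2 := vtx ((k:ℝ)/h) ((j:ℝ)/h)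

/-- `p` is the Lagrange interpolant of `f` on `𝒯_h`: `p ∈ 𝔽_h` and `p = f` on `Δ_h`. -/
def Interpolates (h : ℕ) (f p : E2 → ℝ) : Prop :=
  MemF h p ∧ ∀ x ∈ Delta h, p x = f x

/-- The Lagrange interpolation operator `P_h` (a choice of interpolant; it is unique on `Ω̄`). -/

noncomputable def Ph (h : ℕ) (f : E2 → ℝ) : E2 → ℝ :=
  if hf : ∃ p, Interpolates h f p then hf.choose else 0

/-- Almost-everywhere defined gradient. -/
noncomputable def grad (u : E2 → ℝ) (x : E2) : E2 := gradient u x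

/-- The squared `H¹(Ω)` norm `‖u‖²_{H¹} = ∫_Ω (u² + |∇u|²)`. -/
noncomputable def H1normSq (u : E2 → ℝ) : ℝ :=
  ∫ x in Omega, ((u x)^2 + ‖grad u x‖^2)

/-- The discrete phase-field energy `J_h`. -/
noncomputable def Jh (h : ℕ) (η : ℝ) (u v : E2 → ℝ) : ℝ :=
  (1/2) * (∫ x in Omega, ((Ph h (fun y => (v y)^2) x + η) * ‖grad u x‖^2))
  + (1/2) * (∫ x in Omega, ‖grad v x‖^2)
  + (1/2) * (∫ x in Omega, Ph h (fun y => (1 - v y)^2) x)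

/-- `u ∈ 𝔄_h(w)`: `u ∈ 𝔽_h` and `u = w` on `∂Ω`. -/
def MemA (h : ℕ) (w u : E2 → ℝ) : Prop :=
  MemF h u ∧ ∀ x ∈ OmegaBd, u x = w x

/-- Convergence in `𝔽_h`, i.e. with respect to the `H¹(Ω)` norm. -/
def TendstoF (u : ℕ → E2 → ℝ) (ub : E2 → ℝ) : Prop :=
  Tendsto (fun j => H1normSq (fun y => u j y - ub y)) atTop (nhds 0)

/-- `u` minimizes `J_h(·, v)` over `𝔄_h(w)`. -/
def IsMinU (h : ℕ) (η : ℝ) (w v u : E2 → ℝ) : Prop :=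
  MemA h w u ∧ ∀ u', MemA h w u' → Jh h η u v ≤ Jh h η u' v

/-- `v` minimizes `J_h(u, ·)` over `{v ∈ 𝔽_h : v ≤ vprev on Ω}`. -/
def IsMinV (h : ℕ) (η : ℝ) (u vprev v : E2 → ℝ) : Prop :=
  (MemF h v ∧ ∀ x ∈ Omega, v x ≤ vprev x) ∧
  ∀ v', MemF h v' → (∀ x ∈ Omega, v' x ≤ vprev x) → Jh h η u v ≤ Jh h η u v'

end

noncomputable section

/-- The penalized functional `J̃_ζ(v) = J_h(u, v) + (ζ/2) ∫_Ω P_h([v − v']₊²) dx`. -/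
noncomputable def Jtilde (h : ℕ) (η : ℝ) (u v' : E2 → ℝ) (ζ : ℝ) (v : E2 → ℝ) : ℝ :=
  Jh h η u v + ζ/2 * ∫ x in Omega, Ph h (fun y => (max (v y - v' y) 0)^2) x

end

theorem exists_isMinOn_of_coercive {E : Type*} [TopologicalSpace E] {f : E → ℝ} {s : Set E}
    (hf : Continuous f) (hc : Tendsto f (cocompact E) atTop) (hs : IsClosed s)
    (hne : s.Nonempty) : ∃ a ∈ s, IsMinOn f s a := by
  obtain ⟨x₀, h₀⟩ := hne
  exact hf.continuousOn.exists_isMinOn' hs h₀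
    (Filter.Eventually.filter_mono inf_le_left (hc.eventually_ge_atTop (f x₀)))

/-- Convergence of the penalty method: minimizers of `f + (ζ / 2) p` converge to the minimizer of
`f` over `{p = 0}`, together with the minimal values. -/
theorem tendsto_penalized_minimizers {E : Type*} [TopologicalSpace E] [T2Space E] {f p : E → ℝ}
    (hf : Continuous f) (hc : Tendsto f (cocompact E) atTop) (hp : Continuous p)
    (hp0 : ∀ x, 0 ≤ p x) {a : E} (ha : p a = 0)
    (huniq : ∀ x, p x = 0 → f x ≤ f a → x = a) {z : ℝ → E}
    (hz : ∀ ζ : ℝ, 0 < ζ → ∀ x, f (z ζ) + ζ / 2 * p (z ζ) ≤ f x + ζ / 2 * p x) :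
    Tendsto z atTop (nhds a) ∧
      Tendsto (fun ζ => f (z ζ) + ζ / 2 * p (z ζ)) atTop (nhds (f a)) := by
  have hle : ∀ ζ : ℝ, 0 < ζ → f (z ζ) + ζ / 2 * p (z ζ) ≤ f a := fun ζ hζ => by
    simpa [ha] using hz ζ hζ a
  have hfle : ∀ ζ : ℝ, 0 < ζ → f (z ζ) ≤ f a := fun ζ hζ => by
    have h1 := hle ζ hζ
    have h2 := mul_nonneg (half_pos hζ).le (hp0 (z ζ))
    linarith
  obtain ⟨m, -, hm⟩ := exists_isMinOn_of_coercive hf hc isClosed_univ ⟨a, trivial⟩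
  have hptend : Tendsto (fun ζ => p (z ζ)) atTop (nhds 0) := by
    have hlim : Tendsto (fun ζ : ℝ => 2 * (f a - f m) / ζ) atTop (nhds 0) :=
      tendsto_const_nhds.div_atTop tendsto_id
    refine tendsto_of_tendsto_of_tendsto_of_le_of_le' tendsto_const_nhds hlim
      (Eventually.of_forall fun ζ => hp0 _) ?_
    filter_upwards [eventually_gt_atTop 0] with ζ hζ
    have h1 := hle ζ hζ
    have h2 : f m ≤ f (z ζ) := hm (Set.mem_univ _)
    rw [le_div_iff₀ hζ]
    nlinarith
  obtain ⟨K, hK, hKf⟩ := mem_cocompact.1 (hc.eventually_gt_atTop (f a))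
  have hzt : Tendsto z atTop (nhds a) := by
    refine hK.tendsto_nhds_of_unique_mapClusterPt ?_ ?_
    · filter_upwards [eventually_gt_atTop 0] with ζ hζ
      by_contra hnot
      exact absurd (hKf hnot) (not_lt.2 (hfle ζ hζ))
    · intro x _ hx
      refine huniq x ?_ ?_
      · have h1 : ClusterPt (p x) (map (p ∘ z) atTop) := hx.continuousAt_comp hp.continuousAt
        have h2 : ClusterPt (p x) (nhds 0) := h1.mono hptend
        exact eq_of_nhds_neBot h2
      · refine isClosed_Iic.mem_of_mapClusterPt (s := Set.Iic (f a))
          (hx.continuousAt_comp hf.continuousAt) ?_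
        filter_upwards [eventually_gt_atTop 0] with ζ hζ using hfle ζ hζ
  refine ⟨hzt, ?_⟩
  refine tendsto_of_tendsto_of_tendsto_of_le_of_le' ((hf.tendsto a).comp hzt)
    tendsto_const_nhds ?_ ?_
  · filter_upwards [eventually_gt_atTop 0] with ζ hζ
    exact le_add_of_nonneg_right (mul_nonneg (half_pos hζ).le (hp0 _))
  · filter_upwards [eventually_gt_atTop 0] with ζ hζ using hle ζ hζ

theorem E2.inner_eq (b x : E2) : ⟪b, x⟫ = b 0 * x 0 + b 1 * x 1 := by
  simp [PiLp.inner_apply, Fin.sum_univ_two, mul_comm]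

@[simp] theorem vtx_zero (a b : ℝ) : vtx a b 0 = a := by simp [vtx]

@[simp] theorem vtx_one (a b : ℝ) : vtx a b 1 = b := by simp [vtx]

theorem isAffineOn_of_coeff {u : E2 → ℝ} {S : Set E2} (α β γ : ℝ)
    (H : ∀ x ∈ S, u x = α * x 0 + β * x 1 + γ) : IsAffineOn u S :=
  ⟨vtx α β, γ, fun x hx => by rw [H x hx, E2.inner_eq]; simp⟩

theorem IsAffineOn.linComb {u v : E2 → ℝ} {S : Set E2} (hu : IsAffineOn u S)
    (hv : IsAffineOn v S) (s t : ℝ) : IsAffineOn (fun x => s * u x + t * v x) S := by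
  obtain ⟨b, c, hb⟩ := hu
  obtain ⟨b', c', hb'⟩ := hv
  refine ⟨s • b + t • b', s * c + t * c', fun x hx => ?_⟩
  simp only [hb x hx, hb' x hx, inner_add_left, real_inner_smul_left]
  ring

theorem MemF.linComb {h : ℕ} {u v : E2 → ℝ} (hu : MemF h u) (hv : MemF h v) (s t : ℝ) :
    MemF h (fun x => s * u x + t * v x) := by
  refine ⟨(hu.1.const_smul s).add (hv.1.const_smul t), fun k j h1 h2 h3 h4 => ?_⟩
  exact ⟨(hu.2 k j h1 h2 h3 h4).1.linComb (hv.2 k j h1 h2 h3 h4).1 s t,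
    (hu.2 k j h1 h2 h3 h4).2.linComb (hv.2 k j h1 h2 h3 h4).2 s t⟩

theorem memF_zero (h : ℕ) : MemF h (fun _ => 0) :=
  ⟨continuousOn_const, fun _ _ _ _ _ _ =>
    ⟨isAffineOn_of_coeff 0 0 0 (by simp), isAffineOn_of_coeff 0 0 0 (by simp)⟩⟩

theorem MemF.sub {h : ℕ} {u v : E2 → ℝ} (hu : MemF h u) (hv : MemF h v) :
    MemF h (fun x => u x - v x) := by
  simpa [sub_eq_add_neg] using hu.linComb hv 1 (-1)

theorem memF_sum {h : ℕ} {ι : Type*} (s : Finset ι) (a : ι → ℝ) (g : ι → E2 → ℝ)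
    (hg : ∀ i, MemF h (g i)) : MemF h (fun x => ∑ i ∈ s, a i * g i x) := by
  induction s using Finset.induction_on with
  | empty => simpa using memF_zero h
  | insert i s hi ih =>
    simp only [Finset.sum_insert hi]
    simpa using (hg i).linComb ih (a i) 1

theorem exists_cell {h : ℕ} (hh : 1 ≤ h) {y : ℝ} (hy : y ∈ Set.Icc (0 : ℝ) 1) :
    ∃ k : ℕ, k + 1 ≤ h ∧ (k : ℝ) ≤ h * y ∧ h * y ≤ k + 1 := by
  have hh' : (1 : ℝ) ≤ h := by exact_mod_cast hh
  rcases eq_or_lt_of_le hy.2 with h1 | h1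
  · refine ⟨h - 1, by omega, ?_, ?_⟩ <;> push_cast [Nat.cast_sub hh, h1] <;> linarith
  · have h0 : 0 ≤ h * y := mul_nonneg (by linarith) hy.1
    refine ⟨⌊h * y⌋₊, ?_, Nat.floor_le h0, (Nat.lt_floor_add_one _).le⟩
    have : ⌊h * y⌋₊ < h := (Nat.floor_lt h0).2 (by nlinarith)
    omega

theorem mem_Kplus_succ {h : ℕ} (hh : 1 ≤ h) (k j : ℕ) (x : E2) :
    x ∈ Kplus h (k + 1) (j + 1) ↔ (k : ℝ) ≤ h * x 0 ∧ h * x 0 ≤ k + 1 ∧ (j : ℝ) ≤ h * x 1 ∧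
      h * x 0 + h * x 1 ≤ k + j + 1 := by
  have hpos : (0 : ℝ) < h := by exact_mod_cast hh
  have e : ((j + 1 : ℕ) : ℝ) - 1 = j := by push_cast; ring
  have e' : ((k + 1 : ℕ) : ℝ) - 1 = k := by push_cast; ring
  have e2 : (j : ℝ) / h + (((k + 1 : ℕ) : ℝ) / h - x 0) = (k + j + 1 - h * x 0) / h := by
    push_cast; field_simp; ring
  simp only [Kplus, Set.mem_ofPred_eq, e, e', e2, div_le_iff₀ hpos, le_div_iff₀ hpos]
  push_cast
  constructor <;> rintro ⟨h1, h2, h3, h4⟩ <;> refine ⟨?_, ?_, ?_, ?_⟩ <;> linarith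

theorem mem_Kminus_succ {h : ℕ} (hh : 1 ≤ h) (k j : ℕ) (x : E2) :
    x ∈ Kminus h (k + 1) (j + 1) ↔ (k : ℝ) ≤ h * x 0 ∧ h * x 0 ≤ k + 1 ∧ h * x 1 ≤ j + 1 ∧
      (k : ℝ) + j + 1 ≤ h * x 0 + h * x 1 := by
  have hpos : (0 : ℝ) < h := by exact_mod_cast hh
  have e' : ((k + 1 : ℕ) : ℝ) - 1 = k := by push_cast; ring
  have e2 : ((j + 1 : ℕ) : ℝ) / h + ((k : ℝ) / h - x 0) = (k + j + 1 - h * x 0) / h := by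
    push_cast; field_simp; ring
  simp only [Kminus, Set.mem_ofPred_eq, e', e2, div_le_iff₀ hpos, le_div_iff₀ hpos]
  push_cast
  constructor <;> rintro ⟨h1, h2, h3, h4⟩ <;> refine ⟨?_, ?_, ?_, ?_⟩ <;> linarith

theorem mul_vertexPt_zero {h : ℕ} (hh : 1 ≤ h) (k j : ℕ) : (h : ℝ) * vertexPt h k j 0 = k := by
  have hpos : (0 : ℝ) < h := by exact_mod_cast hh
  simp [vertexPt]; field_simp

theorem mul_vertexPt_one {h : ℕ} (hh : 1 ≤ h) (k j : ℕ) : (h : ℝ) * vertexPt h k j 1 = j := by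
  have hpos : (0 : ℝ) < h := by exact_mod_cast hh
  simp [vertexPt]; field_simp

theorem vertexPt_mem_OmegaCl {h k j : ℕ} (hh : 1 ≤ h) (hk : k ≤ h) (hj : j ≤ h) :
    vertexPt h k j ∈ OmegaCl := by
  have hpos : (0 : ℝ) < h := by exact_mod_cast hh
  have hk' : (k : ℝ) ≤ h := by exact_mod_cast hk
  have hj' : (j : ℝ) ≤ h := by exact_mod_cast hj
  simp only [vertexPt, OmegaCl, Set.mem_ofPred_eq, vtx_zero, vtx_one, Set.mem_Icc]
  exact ⟨⟨by positivity, (div_le_one hpos).2 hk'⟩, ⟨by positivity, (div_le_one hpos).2 hj'⟩⟩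

/-- A finite element function vanishing at all vertices vanishes on the closed square. -/
theorem MemF.eq_zero_of_vertices {h : ℕ} (hh : 1 ≤ h) {d : E2 → ℝ} (hd : MemF h d)
    (h0 : ∀ k j, k ≤ h → j ≤ h → d (vertexPt h k j) = 0) {x : E2} (hx : x ∈ OmegaCl) :
    d x = 0 := by
  have hpos : (0 : ℝ) < h := by exact_mod_cast hh
  obtain ⟨k, hk, hk1, hk2⟩ := exists_cell hh hx.1
  obtain ⟨j, hj, hj1, hj2⟩ := exists_cell hh hx.2
  have key : ∀ S : Set E2, IsAffineOn d S → x ∈ S → ∀ p q r s : ℕ, p ≤ h → q ≤ h → r ≤ h →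
      s ≤ h → p ≠ r → q ≠ s → vertexPt h p q ∈ S → vertexPt h r q ∈ S → vertexPt h p s ∈ S →
      d x = 0 := by
    rintro S ⟨b, c, hb⟩ hxS p q r s hp hq hr hs hpr hqs h1 h2 h3
    have e1 := (hb _ h1).symm.trans (h0 p q hp hq)
    have e2 := (hb _ h2).symm.trans (h0 r q hr hq)
    have e3 := (hb _ h3).symm.trans (h0 p s hp hs)
    have hpr' : (p : ℝ) - r ≠ 0 := sub_ne_zero.2 (by exact_mod_cast hpr)
    have hqs' : (q : ℝ) - s ≠ 0 := sub_ne_zero.2 (by exact_mod_cast hqs)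
    simp only [E2.inner_eq, vertexPt, vtx_zero, vtx_one] at e1 e2 e3
    have hb0 : b 0 = 0 := by
      have : b 0 * ((p : ℝ) - r) = 0 := by
        field_simp at e1 e2
        linarith
      simpa [hpr'] using this
    have hb1 : b 1 = 0 := by
      have : b 1 * ((q : ℝ) - s) = 0 := by
        field_simp at e1 e3
        linarith
      simpa [hqs'] using this
    rw [hb x hxS, E2.inner_eq]
    rw [hb0, hb1] at e1 ⊢
    linarith
  have haff := hd.2 (k + 1) (j + 1) (by omega) hk (by omega) hj
  rcases le_total (h * x 0 + h * x 1) ((k : ℝ) + j + 1) with hle | hle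
  · refine key _ haff.1 ((mem_Kplus_succ hh k j x).2 ⟨hk1, hk2, hj1, hle⟩) k j (k + 1) (j + 1)
      (by omega) (by omega) hk hj (by omega) (by omega) ?_ ?_ ?_ <;>
    · rw [mem_Kplus_succ hh, mul_vertexPt_zero hh, mul_vertexPt_one hh]
      push_cast
      refine ⟨?_, ?_, ?_, ?_⟩ <;> linarith
  · refine key _ haff.2 ((mem_Kminus_succ hh k j x).2 ⟨hk1, hk2, hj2, hle⟩) (k + 1) (j + 1) k j
      hk hj (by omega) (by omega) (by omega) (by omega) ?_ ?_ ?_ <;>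
    · rw [mem_Kminus_succ hh, mul_vertexPt_zero hh, mul_vertexPt_one hh]
      push_cast
      refine ⟨?_, ?_, ?_, ?_⟩ <;> linarith

/-- The nodal basis function of `𝔽_h` attached to the vertex `(k/h, j/h)`. -/
def hat (h k j : ℕ) (x : E2) : ℝ :=
  max 0 (1 - max (max |h * x 0 - k| |h * x 1 - j|) |(h * x 0 - k) + (h * x 1 - j)|)

theorem hat_nonneg (h k j : ℕ) (x : E2) : 0 ≤ hat h k j x := le_max_left _ _

theorem hat_le_one (h k j : ℕ) (x : E2) : hat h k j x ≤ 1 := by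
  refine max_le zero_le_one (sub_le_self _ (le_max_of_le_right (abs_nonneg _)))

theorem continuous_hat (h k j : ℕ) : Continuous (hat h k j) := by
  unfold hat
  fun_prop

theorem hat_vertexPt {h : ℕ} (hh : 1 ≤ h) (k j p q : ℕ) :
    hat h k j (vertexPt h p q) = if p = k ∧ q = j then 1 else 0 := by
  unfold hat
  rw [mul_vertexPt_zero hh, mul_vertexPt_one hh]
  split_ifs with hc
  · simp [hc.1, hc.2]
  · refine max_eq_left (sub_nonpos.2 ?_)
    have key : ∀ m n : ℕ, m ≠ n → (1 : ℝ) ≤ |(m : ℝ) - n| := fun m n hmn => by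
      have : (1 : ℤ) ≤ |(m : ℤ) - n| := Int.one_le_abs (by omega)
      exact_mod_cast this
    by_cases hp : p = k
    · exact le_max_of_le_left (le_max_of_le_right (key q j fun hq => hc ⟨hp, hq⟩))
    · exact le_max_of_le_left (le_max_of_le_left (key p k hp))

theorem hat_eq_zero {h k j : ℕ} {x : E2} (H : 1 ≤ |h * x 0 - k| ∨ 1 ≤ |h * x 1 - j| ∨
    1 ≤ |(h * x 0 - k) + (h * x 1 - j)|) : hat h k j x = 0 := by
  refine max_eq_left (sub_nonpos.2 ?_)
  rcases H with H | H | H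
  · exact le_max_of_le_left (le_max_of_le_left H)
  · exact le_max_of_le_left (le_max_of_le_right H)
  · exact le_max_of_le_right H

theorem hat_eq {h k j : ℕ} {x : E2} {g : ℝ} (h0 : 0 ≤ g) (h1 : |h * x 0 - k| ≤ 1 - g)
    (h2 : |h * x 1 - j| ≤ 1 - g) (h3 : |(h * x 0 - k) + (h * x 1 - j)| ≤ 1 - g)
    (H : 1 - g ≤ |h * x 0 - k| ∨ 1 - g ≤ |h * x 1 - j| ∨
      1 - g ≤ |(h * x 0 - k) + (h * x 1 - j)|) : hat h k j x = g := by
  have : max (max |h * x 0 - k| |h * x 1 - j|) |(h * x 0 - k) + (h * x 1 - j)| = 1 - g := by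
    refine le_antisymm (max_le (max_le h1 h2) h3) ?_
    rcases H with H | H | H
    · exact le_max_of_le_left (le_max_of_le_left H)
    · exact le_max_of_le_left (le_max_of_le_right H)
    · exact le_max_of_le_right H
  rw [hat, this]
  simpa using h0

theorem nat_cases_near (k p : ℕ) : ((p : ℝ) + 1 + 1 ≤ k) ∨ ((p : ℝ) + 1 = k) ∨ ((p : ℝ) = k) ∨
    ((k : ℝ) + 1 ≤ p) := by
  have : p + 1 + 1 ≤ k ∨ p + 1 = k ∨ p = k ∨ k + 1 ≤ p := by omega
  exact_mod_cast this

theorem memF_hat {h : ℕ} (hh : 1 ≤ h) (k j : ℕ) : MemF h (hat h k j) := by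
  refine ⟨(continuous_hat h k j).continuousOn, ?_⟩
  intro p' q' hp _ hq _
  obtain ⟨p, rfl⟩ := Nat.exists_eq_add_of_le' hp
  obtain ⟨q, rfl⟩ := Nat.exists_eq_add_of_le' hq
  constructor
  · simp only [IsAffineOn, mem_Kplus_succ hh]
    have zero : (∀ x : E2, (p : ℝ) ≤ h * x 0 ∧ h * x 0 ≤ p + 1 ∧ (q : ℝ) ≤ h * x 1 ∧
        h * x 0 + h * x 1 ≤ p + q + 1 → 1 ≤ |h * x 0 - k| ∨ 1 ≤ |h * x 1 - j| ∨
        1 ≤ |(h * x 0 - k) + (h * x 1 - j)|) → ∃ (b : E2) (c : ℝ), ∀ x : E2,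
        (p : ℝ) ≤ h * x 0 ∧ h * x 0 ≤ p + 1 ∧ (q : ℝ) ≤ h * x 1 ∧
        h * x 0 + h * x 1 ≤ p + q + 1 → hat h k j x = ⟪b, x⟫ + c := fun H =>
      ⟨0, 0, fun x hx => by simpa using hat_eq_zero (H x hx)⟩
    rcases nat_cases_near k p with hp | hp | hp | hp
    · exact zero fun x hx => .inl (le_abs.2 (.inr (by linarith)))
    · rcases nat_cases_near j q with hq | hq | hq | hq
      · exact zero fun x hx => .inr (.inl (le_abs.2 (.inr (by linarith))))
      · exact zero fun x hx => .inr (.inr (le_abs.2 (.inr (by linarith))))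
      · refine ⟨vtx h 0, 1 - k, fun x ⟨h1, h2, h3, h4⟩ => ?_⟩
        rw [E2.inner_eq, vtx_zero, vtx_one]
        refine hat_eq (by linarith) (abs_le.2 ⟨by linarith, by linarith⟩)
          (abs_le.2 ⟨by linarith, by linarith⟩) (abs_le.2 ⟨by linarith, by linarith⟩)
          (.inl (le_abs.2 (.inr (by linarith))))
      · exact zero fun x hx => .inr (.inl (le_abs.2 (.inl (by linarith))))
    · rcases nat_cases_near j q with hq | hq | hq | hq
      · exact zero fun x hx => .inr (.inl (le_abs.2 (.inr (by linarith))))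
      · refine ⟨vtx 0 h, 1 - j, fun x ⟨h1, h2, h3, h4⟩ => ?_⟩
        rw [E2.inner_eq, vtx_zero, vtx_one]
        refine hat_eq (by linarith) (abs_le.2 ⟨by linarith, by linarith⟩)
          (abs_le.2 ⟨by linarith, by linarith⟩) (abs_le.2 ⟨by linarith, by linarith⟩)
          (.inr (.inl (le_abs.2 (.inr (by linarith)))))
      · refine ⟨vtx (-h) (-h), 1 + k + j, fun x ⟨h1, h2, h3, h4⟩ => ?_⟩
        rw [E2.inner_eq, vtx_zero, vtx_one]
        refine hat_eq (by linarith) (abs_le.2 ⟨by linarith, by linarith⟩)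
          (abs_le.2 ⟨by linarith, by linarith⟩) (abs_le.2 ⟨by linarith, by linarith⟩)
          (.inr (.inr (le_abs.2 (.inl (by linarith)))))
      · exact zero fun x hx => .inr (.inl (le_abs.2 (.inl (by linarith))))
    · exact zero fun x hx => .inl (le_abs.2 (.inl (by linarith)))
  · simp only [IsAffineOn, mem_Kminus_succ hh]
    have zero : (∀ x : E2, (p : ℝ) ≤ h * x 0 ∧ h * x 0 ≤ p + 1 ∧ h * x 1 ≤ q + 1 ∧
        (p : ℝ) + q + 1 ≤ h * x 0 + h * x 1 → 1 ≤ |h * x 0 - k| ∨ 1 ≤ |h * x 1 - j| ∨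
        1 ≤ |(h * x 0 - k) + (h * x 1 - j)|) → ∃ (b : E2) (c : ℝ), ∀ x : E2,
        (p : ℝ) ≤ h * x 0 ∧ h * x 0 ≤ p + 1 ∧ h * x 1 ≤ q + 1 ∧
        (p : ℝ) + q + 1 ≤ h * x 0 + h * x 1 → hat h k j x = ⟪b, x⟫ + c := fun H =>
      ⟨0, 0, fun x hx => by simpa using hat_eq_zero (H x hx)⟩
    rcases nat_cases_near k p with hp | hp | hp | hp
    · exact zero fun x hx => .inl (le_abs.2 (.inr (by linarith)))
    · rcases nat_cases_near j q with hq | hq | hq | hq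
      · exact zero fun x hx => .inr (.inl (le_abs.2 (.inr (by linarith))))
      · refine ⟨vtx h h, 1 - k - j, fun x ⟨h1, h2, h3, h4⟩ => ?_⟩
        rw [E2.inner_eq, vtx_zero, vtx_one]
        refine hat_eq (by linarith) (abs_le.2 ⟨by linarith, by linarith⟩)
          (abs_le.2 ⟨by linarith, by linarith⟩) (abs_le.2 ⟨by linarith, by linarith⟩)
          (.inr (.inr (le_abs.2 (.inr (by linarith)))))
      · refine ⟨vtx 0 (-h), 1 + j, fun x ⟨h1, h2, h3, h4⟩ => ?_⟩
        rw [E2.inner_eq, vtx_zero, vtx_one]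
        refine hat_eq (by linarith) (abs_le.2 ⟨by linarith, by linarith⟩)
          (abs_le.2 ⟨by linarith, by linarith⟩) (abs_le.2 ⟨by linarith, by linarith⟩)
          (.inr (.inl (le_abs.2 (.inl (by linarith)))))
      · exact zero fun x hx => .inr (.inl (le_abs.2 (.inl (by linarith))))
    · rcases nat_cases_near j q with hq | hq | hq | hq
      · exact zero fun x hx => .inr (.inl (le_abs.2 (.inr (by linarith))))
      · refine ⟨vtx (-h) 0, 1 + k, fun x ⟨h1, h2, h3, h4⟩ => ?_⟩
        rw [E2.inner_eq, vtx_zero, vtx_one]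
        refine hat_eq (by linarith) (abs_le.2 ⟨by linarith, by linarith⟩)
          (abs_le.2 ⟨by linarith, by linarith⟩) (abs_le.2 ⟨by linarith, by linarith⟩)
          (.inl (le_abs.2 (.inl (by linarith))))
      · exact zero fun x hx => .inr (.inr (le_abs.2 (.inl (by linarith))))
      · exact zero fun x hx => .inr (.inl (le_abs.2 (.inl (by linarith))))
    · exact zero fun x hx => .inl (le_abs.2 (.inl (by linarith)))

theorem exists_lipschitzWith_hat (h k j : ℕ) : ∃ C, LipschitzWith C (hat h k j) := by
  have habs : ∀ f : E2 → ℝ, (∃ C, LipschitzWith C f) → ∃ C, LipschitzWith C fun x => |f x| :=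
    fun f ⟨C, hC⟩ => ⟨_, lipschitzWith_one_norm.comp hC⟩
  have hcoord : ∀ (i : Fin 2) (m : ℕ), ∃ C, LipschitzWith C fun x : E2 => (h : ℝ) * x i - m :=
    fun i m => ⟨_, (((h : ℝ) • (EuclideanSpace.proj i : E2 →L[ℝ] ℝ)).lipschitz).sub
      (LipschitzWith.const (m : ℝ))⟩
  obtain ⟨C0, hC0⟩ := hcoord 0 k
  obtain ⟨C1, hC1⟩ := hcoord 1 j
  obtain ⟨D0, hD0⟩ := habs _ ⟨C0, hC0⟩
  obtain ⟨D1, hD1⟩ := habs _ ⟨C1, hC1⟩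
  obtain ⟨D2, hD2⟩ := habs _ ⟨_, hC0.add hC1⟩
  exact ⟨_, ((LipschitzWith.const (1 : ℝ)).sub ((hD0.max hD1).max hD2)).const_max 0⟩

/-- Indices of the vertices of `𝒯_h`. -/
abbrev Vert (h : ℕ) : Type := Fin (h + 1) × Fin (h + 1)

/-- The vector of nodal values of a function. -/
noncomputable def nodal (h : ℕ) (v : E2 → ℝ) (i : Vert h) : ℝ := v (vertexPt h i.1 i.2)

/-- The nodal basis function of `𝔽_h` with index `i`. -/
def basisFn (h : ℕ) (i : Vert h) : E2 → ℝ := hat h i.1 i.2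

theorem basisFn_nonneg {h : ℕ} (i : Vert h) (x : E2) : 0 ≤ basisFn h i x := hat_nonneg _ _ _ _

theorem basisFn_le_one {h : ℕ} (i : Vert h) (x : E2) : basisFn h i x ≤ 1 := hat_le_one _ _ _ _

theorem continuous_basisFn {h : ℕ} (i : Vert h) : Continuous (basisFn h i) := continuous_hat _ _ _

theorem nodal_basisFn {h : ℕ} (hh : 1 ≤ h) (i j : Vert h) :
    nodal h (basisFn h i) j = if i = j then 1 else 0 := by
  simp only [nodal, basisFn, hat_vertexPt hh]
  congr 1
  simp only [Prod.ext_iff, Fin.ext_iff, eq_comm]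

/-- The finite element function with nodal values `a`. -/
def interp (h : ℕ) (a : Vert h → ℝ) (x : E2) : ℝ := ∑ i, a i * basisFn h i x

theorem memF_interp {h : ℕ} (hh : 1 ≤ h) (a : Vert h → ℝ) : MemF h (interp h a) :=
  memF_sum _ _ _ fun _ => memF_hat hh _ _

theorem continuous_interp {h : ℕ} (a : Vert h → ℝ) : Continuous (interp h a) :=
  continuous_finsetSum _ fun i _ => continuous_const.mul (continuous_basisFn i)

theorem nodal_interp {h : ℕ} (hh : 1 ≤ h) (a : Vert h → ℝ) : nodal h (interp h a) = a := by
  funext j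
  have : nodal h (interp h a) j = ∑ i, a i * nodal h (basisFn h i) j := rfl
  simp [this, nodal_basisFn hh]

theorem MemF.eqOn_of_nodal_eq {h : ℕ} (hh : 1 ≤ h) {v w : E2 → ℝ} (hv : MemF h v)
    (hw : MemF h w) (H : nodal h v = nodal h w) : Set.EqOn v w OmegaCl := fun x hx => by
  refine sub_eq_zero.1 ((hv.sub hw).eq_zero_of_vertices hh (fun k j hk hj => ?_) hx)
  exact sub_eq_zero.2 (congrFun H (⟨k, by omega⟩, ⟨j, by omega⟩))

theorem nodal_congr {h : ℕ} (hh : 1 ≤ h) {v w : E2 → ℝ} (H : Set.EqOn v w OmegaCl) :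
    nodal h v = nodal h w := by
  funext i
  exact H (vertexPt_mem_OmegaCl hh (by omega) (by omega))

theorem MemF.eq_interp {h : ℕ} (hh : 1 ≤ h) {v : E2 → ℝ} (hv : MemF h v) :
    Set.EqOn v (interp h (nodal h v)) OmegaCl :=
  hv.eqOn_of_nodal_eq hh (memF_interp hh _) (nodal_interp hh _).symm

theorem Ph_eq_interp {h : ℕ} (hh : 1 ≤ h) (f : E2 → ℝ) :
    Set.EqOn (Ph h f) (interp h (nodal h f)) OmegaCl := by
  have hex : ∃ p, Interpolates h f p := by
    refine ⟨interp h (nodal h f), memF_interp hh _, ?_⟩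
    rintro x ⟨k, j, hk, hj, rfl⟩
    exact congrFun (nodal_interp hh (nodal h f)) (⟨k, by omega⟩, ⟨j, by omega⟩)
  have hspec : Interpolates h f (Ph h f) := by
    rw [Ph, dif_pos hex]
    exact hex.choose_spec
  have hn : nodal h (Ph h f) = nodal h f := by
    funext i
    exact hspec.2 _ ⟨i.1, i.2, by omega, by omega, rfl⟩
  have := hspec.1.eq_interp hh
  rwa [hn] at this

theorem Omega_subset_OmegaCl : Omega ⊆ OmegaCl := fun _ hx =>
  ⟨Set.Ioo_subset_Icc_self hx.1, Set.Ioo_subset_Icc_self hx.2⟩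

theorem continuous_coord (i : Fin 2) : Continuous fun x : E2 => x i :=
  (EuclideanSpace.proj i : E2 →L[ℝ] ℝ).continuous

theorem isOpen_Omega : IsOpen Omega :=
  (isOpen_Ioo.preimage (continuous_coord 0)).inter (isOpen_Ioo.preimage (continuous_coord 1))

theorem measurableSet_Omega : MeasurableSet Omega := isOpen_Omega.measurableSet

theorem OmegaCl_subset_closure : OmegaCl ⊆ closure Omega := by
  intro x hx
  have hlim : Tendsto (fun t : ℝ => x + t • (vtx (1 / 2) (1 / 2) - x)) (nhdsWithin 0 (Set.Ioi 0))
      (nhds x) := by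
    have : Continuous fun t : ℝ => x + t • (vtx (1 / 2) (1 / 2) - x) := by fun_prop
    simpa using (this.tendsto 0).mono_left nhdsWithin_le_nhds
  refine mem_closure_of_tendsto hlim ?_
  filter_upwards [Ioo_mem_nhdsGT (zero_lt_one : (0 : ℝ) < 1)] with t ht
  obtain ⟨ht0, ht1⟩ := ht
  obtain ⟨⟨h1, h2⟩, h3, h4⟩ := hx
  refine ⟨⟨?_, ?_⟩, ?_, ?_⟩ <;>
    simp only [PiLp.add_apply, PiLp.smul_apply, PiLp.sub_apply, vtx_zero, vtx_one, smul_eq_mul] <;>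
    nlinarith

theorem volume_Omega_lt_top : volume Omega < ⊤ := by
  refine (Metric.isBounded_iff_subset_closedBall (0 : E2)).2 ⟨2, fun x hx => ?_⟩ |>.measure_lt_top
  obtain ⟨⟨h1, h2⟩, h3, h4⟩ := hx
  rw [mem_closedBall_zero_iff, EuclideanSpace.norm_eq, Fin.sum_univ_two, Real.norm_eq_abs,
    Real.norm_eq_abs, sq_abs, sq_abs]
  refine Real.sqrt_le_iff.2 ⟨by norm_num, by nlinarith⟩

theorem integrableOn_Omega_of_bounded {g : E2 → ℝ} (hg : Measurable g) (C : ℝ)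
    (hC : ∀ x, |g x| ≤ C) : IntegrableOn g Omega :=
  Measure.integrableOn_of_bounded volume_Omega_lt_top.ne hg.aestronglyMeasurable
    (Eventually.of_forall hC)

theorem measurable_grad (v : E2 → ℝ) : Measurable (grad v) :=
  (InnerProductSpace.toDual ℝ E2).symm.continuous.measurable.comp (measurable_fderiv ℝ v)

theorem exists_norm_grad_basisFn_le (h : ℕ) :
    ∃ C : ℝ, 0 ≤ C ∧ ∀ (i : Vert h) (x : E2), ‖grad (basisFn h i) x‖ ≤ C := by
  choose C hC using fun i : Vert h => exists_lipschitzWith_hat h i.1 i.2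
  refine ⟨∑ i, (C i : ℝ), by positivity, fun i x => ?_⟩
  have h1 : ‖grad (basisFn h i) x‖ ≤ C i := by
    rw [grad, gradient, LinearIsometryEquiv.norm_map]
    exact norm_fderiv_le_of_lipschitz ℝ (hC i)
  exact h1.trans (Finset.single_le_sum (f := fun i => (C i : ℝ)) (fun _ _ => NNReal.coe_nonneg _)
    (Finset.mem_univ i))

theorem MemF.ae_grad_eq {h : ℕ} (hh : 1 ≤ h) :
    ∀ᵐ x : E2, x ∈ Omega → ∀ v, MemF h v →
      grad v x = ∑ i, nodal h v i • grad (basisFn h i) x := by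
  have hd : ∀ᵐ x : E2, ∀ i : Vert h, DifferentiableAt ℝ (basisFn h i) x := by
    refine ae_all_iff.2 fun i => ?_
    obtain ⟨C, hC⟩ := exists_lipschitzWith_hat h i.1 i.2
    exact hC.ae_differentiableAt
  filter_upwards [hd] with x hx hxO v hv
  have heq : v =ᶠ[nhds x] fun y => ∑ i, nodal h v i * basisFn h i y := by
    filter_upwards [isOpen_Omega.mem_nhds hxO] with y hy
    exact hv.eq_interp hh (Omega_subset_OmegaCl hy)
  simp only [grad, gradient]
  rw [heq.fderiv_eq, fderiv_fun_sum fun i _ => (hx i).const_mul _, map_sum]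
  refine Finset.sum_congr rfl fun i _ => ?_
  rw [fderiv_const_mul (hx i), map_smulₛₗ]
  simp

/-- Entries of the stiffness matrix. -/
noncomputable def stiffness (h : ℕ) (i j : Vert h) : ℝ :=
  ∫ x in Omega, ⟪grad (basisFn h i) x, grad (basisFn h j) x⟫

/-- Entries of the lumped mass matrix. -/
noncomputable def lumpedMass (h : ℕ) (i : Vert h) : ℝ := ∫ x in Omega, basisFn h i x

/-- Entries of the mass matrix. -/
noncomputable def massEntry (h : ℕ) (i j : Vert h) : ℝ := ∫ x in Omega, basisFn h i x * basisFn h j x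

/-- Nodal weights of the elastic energy density `|∇u|²`. -/
noncomputable def elasticWeight (h : ℕ) (u : E2 → ℝ) (i : Vert h) : ℝ :=
  ∫ x in Omega, basisFn h i x * ‖grad u x‖ ^ 2

theorem integrableOn_basisFn {h : ℕ} (i : Vert h) : IntegrableOn (basisFn h i) Omega :=
  integrableOn_Omega_of_bounded (continuous_basisFn i).measurable 1 fun x => by
    rw [abs_of_nonneg (basisFn_nonneg i x)]; exact basisFn_le_one i x

theorem integrableOn_basisFn_mul {h : ℕ} (i j : Vert h) :
    IntegrableOn (fun x => basisFn h i x * basisFn h j x) Omega :=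
  integrableOn_Omega_of_bounded
    ((continuous_basisFn i).measurable.mul (continuous_basisFn j).measurable) 1 fun x => by
      rw [abs_of_nonneg (mul_nonneg (basisFn_nonneg i x) (basisFn_nonneg j x))]
      exact mul_le_one₀ (basisFn_le_one i x) (basisFn_nonneg j x) (basisFn_le_one j x)

theorem integrableOn_inner_grad {h : ℕ} (i j : Vert h) :
    IntegrableOn (fun x => ⟪grad (basisFn h i) x, grad (basisFn h j) x⟫) Omega := by
  obtain ⟨C, hC0, hC⟩ := exists_norm_grad_basisFn_le h
  refine integrableOn_Omega_of_bounded ((measurable_grad _).inner (measurable_grad _)) (C * C)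
    fun x => ?_
  exact (abs_real_inner_le_norm _ _).trans
    (mul_le_mul (hC i x) (hC j x) (norm_nonneg _) hC0)

theorem norm_sum_smul_sq {ι : Type*} [Fintype ι] (a : ι → ℝ) (g : ι → E2) :
    ‖∑ i, a i • g i‖ ^ 2 = ∑ i, ∑ j, a i * a j * ⟪g i, g j⟫ := by
  rw [← real_inner_self_eq_norm_sq, sum_inner]
  refine Finset.sum_congr rfl fun i _ => ?_
  rw [inner_sum]
  refine Finset.sum_congr rfl fun j _ => ?_
  rw [real_inner_smul_left, real_inner_smul_right]
  ring

theorem MemF.ae_norm_grad_sq_eq {h : ℕ} (hh : 1 ≤ h) {v : E2 → ℝ} (hv : MemF h v) :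
    ∀ᵐ x : E2, x ∈ Omega → ‖grad v x‖ ^ 2 = ∑ i, ∑ j,
      nodal h v i * nodal h v j * ⟪grad (basisFn h i) x, grad (basisFn h j) x⟫ := by
  filter_upwards [MemF.ae_grad_eq hh] with x hx hxO
  rw [hx hxO v hv, norm_sum_smul_sq]

theorem MemF.integrableOn_norm_grad_sq {h : ℕ} (hh : 1 ≤ h) {v : E2 → ℝ} (hv : MemF h v) :
    IntegrableOn (fun x => ‖grad v x‖ ^ 2) Omega := by
  have : IntegrableOn (fun x => ∑ i, ∑ j,
      nodal h v i * nodal h v j * ⟪grad (basisFn h i) x, grad (basisFn h j) x⟫) Omega :=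
    integrable_finsetSum _ fun i _ => integrable_finsetSum _ fun j _ =>
      (integrableOn_inner_grad i j).const_mul _
  refine this.congr ?_
  rw [Filter.EventuallyEq, ae_restrict_iff' measurableSet_Omega]
  filter_upwards [hv.ae_norm_grad_sq_eq hh] with x hx hxO using (hx hxO).symm

theorem MemF.integral_norm_grad_sq {h : ℕ} (hh : 1 ≤ h) {v : E2 → ℝ} (hv : MemF h v) :
    ∫ x in Omega, ‖grad v x‖ ^ 2 =
      ∑ i, ∑ j, nodal h v i * nodal h v j * stiffness h i j := by
  rw [setIntegral_congr_ae measurableSet_Omega (hv.ae_norm_grad_sq_eq hh),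
    integral_finsetSum _ fun i _ => integrable_finsetSum _ fun j _ =>
      (integrableOn_inner_grad i j).const_mul _]
  refine Finset.sum_congr rfl fun i _ => ?_
  rw [integral_finsetSum _ fun j _ => (integrableOn_inner_grad i j).const_mul _]
  exact Finset.sum_congr rfl fun j _ => integral_const_mul _ _

theorem integral_Ph {h : ℕ} (hh : 1 ≤ h) (f : E2 → ℝ) :
    ∫ x in Omega, Ph h f x = ∑ i, nodal h f i * lumpedMass h i := by
  rw [setIntegral_congr_fun measurableSet_Omega ((Ph_eq_interp hh f).mono Omega_subset_OmegaCl)]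
  simp only [interp]
  rw [integral_finsetSum _ fun i _ => (integrableOn_basisFn i).const_mul _]
  exact Finset.sum_congr rfl fun j _ => integral_const_mul _ _

theorem MemF.integrableOn_basisFn_mul_norm_grad_sq {h : ℕ} (hh : 1 ≤ h) {u : E2 → ℝ}
    (hu : MemF h u) (i : Vert h) :
    IntegrableOn (fun x => basisFn h i x * ‖grad u x‖ ^ 2) Omega := by
  refine (hu.integrableOn_norm_grad_sq hh).mono'
    (((continuous_basisFn i).measurable.mul
      ((measurable_grad u).norm.pow_const 2)).aestronglyMeasurable) (Eventually.of_forall fun x => ?_)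
  rw [Real.norm_of_nonneg (mul_nonneg (basisFn_nonneg i x) (sq_nonneg _))]
  exact mul_le_of_le_one_left (sq_nonneg _) (basisFn_le_one i x)

theorem integral_Ph_add_mul {h : ℕ} (hh : 1 ≤ h) {u : E2 → ℝ} (hu : MemF h u) (η : ℝ)
    (f : E2 → ℝ) :
    ∫ x in Omega, (Ph h f x + η) * ‖grad u x‖ ^ 2 =
      ∑ i, nodal h f i * elasticWeight h u i + η * ∫ x in Omega, ‖grad u x‖ ^ 2 := by
  have heq : Set.EqOn (fun x => (Ph h f x + η) * ‖grad u x‖ ^ 2)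
      (fun x => ∑ i, nodal h f i * (basisFn h i x * ‖grad u x‖ ^ 2) + η * ‖grad u x‖ ^ 2)
      Omega := fun x hx => by
    simp only [Ph_eq_interp hh f (Omega_subset_OmegaCl hx), interp, add_mul, Finset.sum_mul,
      mul_assoc]
  have hint := fun i (_ : i ∈ Finset.univ) =>
    (hu.integrableOn_basisFn_mul_norm_grad_sq hh i).const_mul (nodal h f i)
  rw [setIntegral_congr_fun measurableSet_Omega heq,
    integral_add (integrable_finsetSum _ hint) ((hu.integrableOn_norm_grad_sq hh).const_mul _),
    integral_finsetSum _ hint, integral_const_mul]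
  congr 1
  exact Finset.sum_congr rfl fun j _ => integral_const_mul _ _

theorem MemF.H1normSq_eq {h : ℕ} (hh : 1 ≤ h) {v : E2 → ℝ} (hv : MemF h v) :
    H1normSq v = ∑ i, ∑ j, nodal h v i * nodal h v j * (massEntry h i j + stiffness h i j) := by
  have hsq : Set.EqOn (fun x => v x ^ 2) (fun x => ∑ i, ∑ j,
      nodal h v i * nodal h v j * (basisFn h i x * basisFn h j x)) Omega := fun x hx => by
    simp only [hv.eq_interp hh (Omega_subset_OmegaCl hx), interp, sq, Finset.sum_mul_sum]
    exact Finset.sum_congr rfl fun i _ => Finset.sum_congr rfl fun j _ => by ring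
  have hint : ∀ i, IntegrableOn (fun x => ∑ j,
      nodal h v i * nodal h v j * (basisFn h i x * basisFn h j x)) Omega := fun i =>
    integrable_finsetSum _ fun j _ => (integrableOn_basisFn_mul i j).const_mul _
  have hint' : IntegrableOn (fun x => v x ^ 2) Omega :=
    IntegrableOn.congr_fun (integrable_finsetSum _ fun i _ => hint i) hsq.symm measurableSet_Omega
  rw [H1normSq, integral_add hint' (hv.integrableOn_norm_grad_sq hh), hv.integral_norm_grad_sq hh,
    setIntegral_congr_fun measurableSet_Omega hsq, integral_finsetSum _ fun i _ => hint i,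
    ← Finset.sum_add_distrib]
  refine Finset.sum_congr rfl fun i _ => ?_
  rw [integral_finsetSum _ fun j _ => (integrableOn_basisFn_mul i j).const_mul _,
    ← Finset.sum_add_distrib]
  refine Finset.sum_congr rfl fun j _ => ?_
  rw [integral_const_mul, massEntry]
  ring

theorem lumpedMass_pos {h : ℕ} (hh : 1 ≤ h) (i : Vert h) : 0 < lumpedMass h i := by
  have hsupp : IsOpen (Function.support (basisFn h i)) := (continuous_basisFn i).isOpen_support
  rw [lumpedMass, setIntegral_pos_iff_support_of_nonneg_ae
    (Eventually.of_forall fun x => basisFn_nonneg i x) (integrableOn_basisFn i)]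
  refine (hsupp.inter isOpen_Omega).measure_pos _ ?_
  refine mem_closure_iff.1 (OmegaCl_subset_closure (vertexPt_mem_OmegaCl hh (k := i.1) (j := i.2)
    (by omega) (by omega))) _ hsupp ?_
  have : basisFn h i (vertexPt h i.1 i.2) = 1 := by simpa [nodal] using nodal_basisFn hh i i
  simp [this]

theorem elasticWeight_nonneg {h : ℕ} (u : E2 → ℝ) (i : Vert h) : 0 ≤ elasticWeight h u i :=
  integral_nonneg fun x => mul_nonneg (basisFn_nonneg i x) (sq_nonneg _)

theorem stiffness_nonneg {h : ℕ} (hh : 1 ≤ h) (a : Vert h → ℝ) :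
    0 ≤ ∑ i, ∑ j, a i * a j * stiffness h i j := by
  have := (memF_interp hh a).integral_norm_grad_sq hh
  rw [nodal_interp hh] at this
  rw [← this]
  exact integral_nonneg fun x => sq_nonneg _

theorem MemF.le_iff_nodal_le {h : ℕ} (hh : 1 ≤ h) {v w : E2 → ℝ} (hv : MemF h v)
    (hw : MemF h w) : (∀ x ∈ Omega, v x ≤ w x) ↔ nodal h v ≤ nodal h w := by
  constructor
  · intro H i
    have hle : ∀ x ∈ closure Omega, interp h (nodal h v) x ≤ interp h (nodal h w) x :=
      closure_minimal (t := {x | interp h (nodal h v) x ≤ interp h (nodal h w) x})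
        (fun x hx => by
          have hx' := Omega_subset_OmegaCl hx
          rw [Set.mem_ofPred_eq, ← hv.eq_interp hh hx', ← hw.eq_interp hh hx']
          exact H x hx) (isClosed_le (continuous_interp _) (continuous_interp _))
    have hi : vertexPt h i.1 i.2 ∈ OmegaCl := vertexPt_mem_OmegaCl hh (by omega) (by omega)
    have := hle _ (OmegaCl_subset_closure hi)
    rwa [← hv.eq_interp hh hi, ← hw.eq_interp hh hi] at this
  · intro H x hx
    rw [hv.eq_interp hh (Omega_subset_OmegaCl hx), hw.eq_interp hh (Omega_subset_OmegaCl hx)]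
    exact Finset.sum_le_sum fun i _ => mul_le_mul_of_nonneg_right (H i) (basisFn_nonneg i x)


/-- The energy `J_h(u, ·)` in terms of nodal values. -/
noncomputable def nodalEnergy (h : ℕ) (η : ℝ) (u : E2 → ℝ) (a : Vert h → ℝ) : ℝ :=
  (1 / 2) * (∑ i, a i ^ 2 * elasticWeight h u i + η * ∫ x in Omega, ‖grad u x‖ ^ 2)
  + (1 / 2) * (∑ i, ∑ j, a i * a j * stiffness h i j)
  + (1 / 2) * (∑ i, (1 - a i) ^ 2 * lumpedMass h i)

/-- The penalty term in terms of nodal values. -/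
noncomputable def nodalPenalty (h : ℕ) (b a : Vert h → ℝ) : ℝ :=
  ∑ i, max (a i - b i) 0 ^ 2 * lumpedMass h i

theorem MemF.Jh_eq {h : ℕ} (hh : 1 ≤ h) (η : ℝ) {u v : E2 → ℝ} (hu : MemF h u)
    (hv : MemF h v) : Jh h η u v = nodalEnergy h η u (nodal h v) := by
  rw [Jh, integral_Ph_add_mul hh hu, hv.integral_norm_grad_sq hh, integral_Ph hh]
  rfl

theorem MemF.Jtilde_eq {h : ℕ} (hh : 1 ≤ h) (η ζ : ℝ) {u v : E2 → ℝ} (v' : E2 → ℝ)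
    (hu : MemF h u) (hv : MemF h v) : Jtilde h η u v' ζ v =
      nodalEnergy h η u (nodal h v) + ζ / 2 * nodalPenalty h (nodal h v') (nodal h v) := by
  rw [Jtilde, hu.Jh_eq hh η hv, integral_Ph hh]
  rfl

theorem continuous_nodalEnergy (h : ℕ) (η : ℝ) (u : E2 → ℝ) :
    Continuous (nodalEnergy h η u) := by
  unfold nodalEnergy
  fun_prop

theorem continuous_nodalPenalty (h : ℕ) (b : Vert h → ℝ) : Continuous (nodalPenalty h b) := by
  unfold nodalPenalty
  fun_prop

theorem nodalPenalty_nonneg {h : ℕ} (hh : 1 ≤ h) (b a : Vert h → ℝ) : 0 ≤ nodalPenalty h b a :=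
  Finset.sum_nonneg fun i _ => mul_nonneg (sq_nonneg _) (lumpedMass_pos hh i).le

theorem nodalPenalty_eq_zero_iff {h : ℕ} (hh : 1 ≤ h) {b a : Vert h → ℝ} :
    nodalPenalty h b a = 0 ↔ a ≤ b := by
  rw [nodalPenalty, Finset.sum_eq_zero_iff_of_nonneg fun i _ =>
    mul_nonneg (sq_nonneg _) (lumpedMass_pos hh i).le]
  simp [(lumpedMass_pos hh _).ne', Pi.le_def]

theorem quadratic_sum_convexity {ι : Type*} [Fintype ι] (g : ι → ι → ℝ) (a b : ι → ℝ)
    {s t : ℝ} (hst : s + t = 1) :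
    ∑ i, ∑ j, (s * a i + t * b i) * (s * a j + t * b j) * g i j =
      s * ∑ i, ∑ j, a i * a j * g i j + t * ∑ i, ∑ j, b i * b j * g i j -
        s * t * ∑ i, ∑ j, (a i - b i) * (a j - b j) * g i j := by
  simp only [Finset.mul_sum, ← Finset.sum_add_distrib, ← Finset.sum_sub_distrib]
  refine Finset.sum_congr rfl fun i _ => Finset.sum_congr rfl fun j _ => ?_
  obtain rfl : t = 1 - s := by linarith
  ring

theorem strictConvexOn_nodalEnergy {h : ℕ} (hh : 1 ≤ h) (η : ℝ) (u : E2 → ℝ) :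
    StrictConvexOn ℝ Set.univ (nodalEnergy h η u) := by
  refine ⟨convex_univ, fun a _ b _ hab s t hs ht hst => ?_⟩
  obtain ⟨i₀, hi₀⟩ := Function.ne_iff.1 hab
  have h1 : ∑ i, (s * a i + t * b i) ^ 2 * elasticWeight h u i ≤
      s * ∑ i, a i ^ 2 * elasticWeight h u i + t * ∑ i, b i ^ 2 * elasticWeight h u i := by
    rw [Finset.mul_sum, Finset.mul_sum, ← Finset.sum_add_distrib]
    refine Finset.sum_le_sum fun i _ => ?_
    have h0 : 0 ≤ s * t * (a i - b i) ^ 2 * elasticWeight h u i :=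
      mul_nonneg (by positivity) (elasticWeight_nonneg u i)
    obtain rfl : t = 1 - s := by linarith
    linarith
  have h2 := quadratic_sum_convexity (stiffness h) a b hst
  have h2' := mul_nonneg (mul_pos hs ht).le (stiffness_nonneg hh fun i => a i - b i)
  have h3 : ∑ i, (1 - (s * a i + t * b i)) ^ 2 * lumpedMass h i <
      s * ∑ i, (1 - a i) ^ 2 * lumpedMass h i + t * ∑ i, (1 - b i) ^ 2 * lumpedMass h i := by
    rw [Finset.mul_sum, Finset.mul_sum, ← Finset.sum_add_distrib]
    refine Finset.sum_lt_sum (fun i _ => ?_) ⟨i₀, Finset.mem_univ _, ?_⟩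
    · have h0 : 0 ≤ s * t * (a i - b i) ^ 2 * lumpedMass h i :=
        mul_nonneg (by positivity) (lumpedMass_pos hh i).le
      obtain rfl : t = 1 - s := by linarith
      linarith
    · have h0 : 0 < s * t * (a i₀ - b i₀) ^ 2 * lumpedMass h i₀ :=
        mul_pos (mul_pos (mul_pos hs ht) (sq_pos_of_ne_zero (sub_ne_zero.2 hi₀)))
          (lumpedMass_pos hh i₀)
      obtain rfl : t = 1 - s := by linarith
      linarith
  have h4 : s * (η * ∫ x in Omega, ‖grad u x‖ ^ 2) + t * (η * ∫ x in Omega, ‖grad u x‖ ^ 2) =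
      η * ∫ x in Omega, ‖grad u x‖ ^ 2 := by rw [← add_mul, hst, one_mul]
  simp only [nodalEnergy, Pi.add_apply, Pi.smul_apply, smul_eq_mul]
  linarith

theorem convexOn_nodalPenalty {h : ℕ} (hh : 1 ≤ h) (b : Vert h → ℝ) :
    ConvexOn ℝ Set.univ (nodalPenalty h b) := by
  refine ⟨convex_univ, fun x _ y _ s t hs ht hst => ?_⟩
  simp only [nodalPenalty, smul_eq_mul, Pi.add_apply, Pi.smul_apply]
  rw [Finset.mul_sum, Finset.mul_sum, ← Finset.sum_add_distrib]
  refine Finset.sum_le_sum fun i _ => ?_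
  rw [← mul_assoc, ← mul_assoc, ← add_mul]
  refine mul_le_mul_of_nonneg_right ?_ (lumpedMass_pos hh i).le
  set p := max (x i - b i) 0
  set q := max (y i - b i) 0
  have hp : x i - b i ≤ p := le_max_left _ _
  have hq : y i - b i ≤ q := le_max_left _ _
  have hp0 : 0 ≤ p := le_max_right _ _
  have hq0 : 0 ≤ q := le_max_right _ _
  have hle : max (s * x i + t * y i - b i) 0 ≤ s * p + t * q := by
    refine max_le ?_ (by positivity)
    have e : s * x i + t * y i - b i = s * (x i - b i) + t * (y i - b i) := by
      linear_combination b i * hst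
    rw [e]
    gcongr
  have h0 : 0 ≤ s * t * (p - q) ^ 2 := by positivity
  refine (pow_le_pow_left₀ (le_max_right _ _) hle 2).trans ?_
  obtain rfl : t = 1 - s := by linarith
  linarith

theorem tendsto_nodalEnergy {h : ℕ} (hh : 1 ≤ h) {η : ℝ} (hη : 0 ≤ η) (u : E2 → ℝ) :
    Tendsto (nodalEnergy h η u) (cocompact (Vert h → ℝ)) atTop := by
  obtain ⟨i₀, -, hmin⟩ := Finset.exists_min_image Finset.univ (lumpedMass h)
    ⟨((0, 0) : Vert h), Finset.mem_univ _⟩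
  have hm := lumpedMass_pos hh i₀
  have hbound : ∀ a : Vert h → ℝ,
      (1 / 2) * ((1 / 2) * ‖a‖ ^ 2 - 1) * lumpedMass h i₀ ≤ nodalEnergy h η u a := by
    intro a
    obtain ⟨j, hj⟩ : ∃ j, ‖a‖ = |a j| := by
      obtain ⟨j, -, hj⟩ := Finset.exists_max_image Finset.univ (fun j => ‖a j‖)
        ⟨((0, 0) : Vert h), Finset.mem_univ _⟩
      exact ⟨j, le_antisymm ((pi_norm_le_iff_of_nonneg (abs_nonneg _)).2 fun i =>
        hj i (Finset.mem_univ _)) (norm_le_pi_norm a j)⟩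
    have h1 : 0 ≤ ∑ i, a i ^ 2 * elasticWeight h u i :=
      Finset.sum_nonneg fun i _ => mul_nonneg (sq_nonneg _) (elasticWeight_nonneg u i)
    have h2 : 0 ≤ η * ∫ x in Omega, ‖grad u x‖ ^ 2 :=
      mul_nonneg hη (integral_nonneg fun x => sq_nonneg _)
    have h3 := stiffness_nonneg hh a
    have h4 : (1 - a j) ^ 2 * lumpedMass h j ≤ ∑ i, (1 - a i) ^ 2 * lumpedMass h i :=
      Finset.single_le_sum (f := fun i => (1 - a i) ^ 2 * lumpedMass h i)
        (fun i _ => mul_nonneg (sq_nonneg _) (lumpedMass_pos hh i).le) (Finset.mem_univ j)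
    have h5 : (1 - a j) ^ 2 * lumpedMass h i₀ ≤ (1 - a j) ^ 2 * lumpedMass h j :=
      mul_le_mul_of_nonneg_left (hmin j (Finset.mem_univ _)) (sq_nonneg _)
    have h6 : ((1 / 2) * ‖a‖ ^ 2 - 1) * lumpedMass h i₀ ≤ (1 - a j) ^ 2 * lumpedMass h i₀ := by
      refine mul_le_mul_of_nonneg_right ?_ hm.le
      rw [hj, sq_abs]
      nlinarith [sq_nonneg (a j - 2)]
    rw [nodalEnergy]
    linarith
  refine tendsto_atTop_mono hbound ?_
  refine Tendsto.atTop_mul_const hm (Tendsto.const_mul_atTop (by norm_num) ?_)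
  refine tendsto_atTop_add_const_right _ _ (Tendsto.const_mul_atTop (by norm_num) ?_)
  exact (tendsto_pow_atTop two_ne_zero).comp (tendsto_norm_cocompact_atTop)

/-- For each `ζ > 0` the penalized functional `J̃_ζ` is strictly convex and
coercive on `𝔽_h` and has a unique minimizer `v_ζ`; as `ζ → ∞`, `v_ζ` converges in `𝔽_h` to
the unique minimizer `v*` of `J_h(u, ·)` over `{v ∈ 𝔽_h : v ≤ v' on Ω}` and
`min J̃_ζ → J_h(u, v*)`. -/
theorem statement15 (h : ℕ) (hh : 1 ≤ h) (η : ℝ) (hη : 0 < η)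
    (u v' : E2 → ℝ) (hu : MemF h u) (hv' : MemF h v') :
    (∀ ζ : ℝ, 0 < ζ →
      -- strict convexity on 𝔽_h
      (∀ v₁ v₂ : E2 → ℝ, MemF h v₁ → MemF h v₂ → ¬ Set.EqOn v₁ v₂ OmegaCl →
        ∀ t : ℝ, 0 < t → t < 1 →
          Jtilde h η u v' ζ (fun y => t * v₁ y + (1 - t) * v₂ y)
            < t * Jtilde h η u v' ζ v₁ + (1 - t) * Jtilde h η u v' ζ v₂) ∧
      -- coercivity on 𝔽_h
      (∀ A : ℝ, ∃ R : ℝ, ∀ v : E2 → ℝ, MemF h v → R ≤ H1normSq v →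
        A ≤ Jtilde h η u v' ζ v) ∧
      -- existence and uniqueness of the minimizer
      (∃ vz : E2 → ℝ, MemF h vz ∧
        (∀ v, MemF h v → Jtilde h η u v' ζ vz ≤ Jtilde h η u v' ζ v) ∧
        (∀ vz', MemF h vz' →
          (∀ v, MemF h v → Jtilde h η u v' ζ vz' ≤ Jtilde h η u v' ζ v) →
          Set.EqOn vz' vz OmegaCl))) ∧
    (∃ vstar : E2 → ℝ,
      (MemF h vstar ∧ (∀ x ∈ Omega, vstar x ≤ v' x) ∧
        (∀ v, MemF h v → (∀ x ∈ Omega, v x ≤ v' x) →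
          Jh h η u vstar ≤ Jh h η u v) ∧
        (∀ v1, MemF h v1 → (∀ x ∈ Omega, v1 x ≤ v' x) →
          (∀ v, MemF h v → (∀ x ∈ Omega, v x ≤ v' x) → Jh h η u v1 ≤ Jh h η u v) →
          Set.EqOn v1 vstar OmegaCl)) ∧
      ∀ vsel : ℝ → E2 → ℝ,
        (∀ ζ : ℝ, 0 < ζ → MemF h (vsel ζ) ∧
          ∀ v, MemF h v → Jtilde h η u v' ζ (vsel ζ) ≤ Jtilde h η u v' ζ v) →
        Tendsto (fun ζ => H1normSq (fun y => vsel ζ y - vstar y)) atTop (nhds 0) ∧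
        Tendsto (fun ζ => Jtilde h η u v' ζ (vsel ζ)) atTop (nhds (Jh h η u vstar))) := by
  have hfc := continuous_nodalEnergy h η u
  have hfs := strictConvexOn_nodalEnergy hh η u
  have hft := tendsto_nodalEnergy hh hη.le u
  have hpc := continuous_nodalPenalty h (nodal h v')
  have hpx := convexOn_nodalPenalty hh (nodal h v')
  have hp0 := nodalPenalty_nonneg hh (nodal h v')
  constructor
  · intro ζ hζ
    set F : (Vert h → ℝ) → ℝ := fun a =>
      nodalEnergy h η u a + ζ / 2 * nodalPenalty h (nodal h v') a with hF
    have hJ : ∀ v, MemF h v → Jtilde h η u v' ζ v = F (nodal h v) := fun v hv =>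
      hu.Jtilde_eq hh η ζ v' hv
    have hFs : StrictConvexOn ℝ Set.univ F := by
      simpa [hF, Pi.add_def] using hfs.add_convexOn (hpx.smul (half_pos hζ).le)
    have hFle : ∀ a, nodalEnergy h η u a ≤ F a := fun a =>
      le_add_of_nonneg_right (mul_nonneg (half_pos hζ).le (hp0 a))
    have hFc : Continuous F := hfc.add (continuous_const.mul hpc)
    have hFt : Tendsto F (cocompact _) atTop := tendsto_atTop_mono hFle hft
    refine ⟨fun v₁ v₂ h₁ h₂ hne t ht0 ht1 => ?_, fun A => ?_, ?_⟩
    · rw [hJ _ h₁, hJ _ h₂, hJ _ (h₁.linComb h₂ t (1 - t))]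
      exact hFs.2 (Set.mem_univ _) (Set.mem_univ _)
        (fun H => hne (h₁.eqOn_of_nodal_eq hh h₂ H)) ht0 (sub_pos.2 ht1) (by ring)
    · obtain ⟨K, hK, hKF⟩ := mem_cocompact.1 (hFt.eventually_ge_atTop A)
      have hHc : Continuous fun a : Vert h → ℝ =>
          ∑ i, ∑ j, a i * a j * (massEntry h i j + stiffness h i j) := by fun_prop
      obtain ⟨M, hM⟩ := hK.bddAbove_image hHc.continuousOn
      refine ⟨M + 1, fun v hv hR => ?_⟩
      rw [hJ v hv]
      refine hKF fun hmem => ?_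
      have := hM (Set.mem_image_of_mem _ hmem)
      rw [hv.H1normSq_eq hh] at hR
      linarith
    · obtain ⟨a, -, ha⟩ := exists_isMinOn_of_coercive hFc hFt isClosed_univ ⟨0, trivial⟩
      refine ⟨interp h a, memF_interp hh a, fun v hv => ?_, fun w hw hmin => ?_⟩
      · rw [hJ _ (memF_interp hh a), hJ _ hv, nodal_interp hh]
        exact ha (Set.mem_univ _)
      · refine hw.eqOn_of_nodal_eq hh (memF_interp hh a) ?_
        rw [nodal_interp hh]
        refine hFs.eq_of_isMinOn (fun b _ => ?_) ha (Set.mem_univ _) (Set.mem_univ _)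
        have := hmin _ (memF_interp hh b)
        rwa [hJ _ hw, hJ _ (memF_interp hh b), nodal_interp hh] at this
  · obtain ⟨a, hab, ha⟩ := exists_isMinOn_of_coercive hfc hft
      (isClosed_Iic (a := nodal h v')) ⟨nodal h v', Set.self_mem_Iic⟩
    have huniq : ∀ b, b ≤ nodal h v' → nodalEnergy h η u b ≤ nodalEnergy h η u a → b = a :=
      fun b hb hle => (hfs.subset (Set.subset_univ _) (convex_Iic _)).eq_of_isMinOn
        (fun c hc => hle.trans (ha hc)) ha hb hab
    have hI := memF_interp hh a
    refine ⟨interp h a, ⟨hI, ?_, fun v hv hle => ?_, fun w hw hle hmin => ?_⟩,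
      fun vsel hsel => ?_⟩
    · rw [hI.le_iff_nodal_le hh hv', nodal_interp hh]
      exact hab
    · rw [hu.Jh_eq hh η hI, hu.Jh_eq hh η hv, nodal_interp hh]
      exact ha ((hv.le_iff_nodal_le hh hv').1 hle)
    · refine hw.eqOn_of_nodal_eq hh hI ?_
      rw [nodal_interp hh]
      refine huniq _ ((hw.le_iff_nodal_le hh hv').1 hle) ?_
      have := hmin _ hI ((hI.le_iff_nodal_le hh hv').2 (by rw [nodal_interp hh]; exact hab))
      rwa [hu.Jh_eq hh η hw, hu.Jh_eq hh η hI, nodal_interp hh] at this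
    · have hconv := tendsto_penalized_minimizers hfc hft hpc hp0
        ((nodalPenalty_eq_zero_iff hh).2 hab)
        (fun b hb => huniq b ((nodalPenalty_eq_zero_iff hh).1 hb))
        (z := fun ζ => nodal h (vsel ζ)) (fun ζ hζ b => by
          have := (hsel ζ hζ).2 _ (memF_interp hh b)
          rwa [hu.Jtilde_eq hh η ζ v' (hsel ζ hζ).1, hu.Jtilde_eq hh η ζ v' (memF_interp hh b),
            nodal_interp hh] at this)
      constructor
      · have hHc : Continuous fun b : Vert h → ℝ =>
            ∑ i, ∑ j, (b i - a i) * (b j - a j) * (massEntry h i j + stiffness h i j) := by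
          fun_prop
        have hlim := (hHc.tendsto a).comp hconv.1
        simp only [sub_self, zero_mul, Finset.sum_const_zero] at hlim
        refine hlim.congr' ?_
        filter_upwards [eventually_gt_atTop 0] with ζ hζ
        rw [((hsel ζ hζ).1.sub hI).H1normSq_eq hh]
        have hn : nodal h (fun y => vsel ζ y - interp h a y) = nodal h (vsel ζ) - a := by
          conv_rhs => rw [← nodal_interp hh a]
          rfl
        rw [hn]
        rfl
      · rw [hu.Jh_eq hh η hI, nodal_interp hh]
        refine hconv.2.congr' ?_
        filter_upwards [eventually_gt_atTop 0] with ζ hζ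
        exact (hu.Jtilde_eq hh η ζ v' (hsel ζ hζ).1).symm
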